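/- Let F be uniformly elliptic with constants 0 < λ ≤ Λ and let u solve the fully nonlinear obstacle problem in Ω with obstacle φ semiconvex with nondecreasing modulus of semiconvexity ω. Then φ has modulus of continuity ω up to first order on the contact set: there is a constant C depending only on n, λ, Λ such that for all x₀, x₁ ∈ {u = φ} with ρ := |x₁ − x₀| and B_{4ρ}(x₀) ⊂ Ω, one has |φ(x₁) − φ(x₀) − ⟨p, x₁ − x₀⟩| ≤ C·ω(4ρ), where p is the slope of a linear part of φ at x₀. -/

import Mathlib

open MeasureTheory Metric Set
open scoped RealInnerProductSpace

noncomputable section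

/-- Euclidean space ℝⁿ. -/
abbrev Euc (n : ℕ) := EuclideanSpace ℝ (Fin n)

/-- The operator norm of an `n × n` real matrix, viewed as a linear map on ℝⁿ. -/
def opNorm {n : ℕ} (A : Matrix (Fin n) (Fin n) ℝ) : ℝ :=
  ‖Matrix.toEuclideanCLM (𝕜 := ℝ) A‖

/-- The Hessian matrix `D²u(x)` of `u : ℝⁿ → ℝ` at `x`. -/
def hess2 {n : ℕ} (u : Euc n → ℝ) (x : Euc n) : Matrix (Fin n) (Fin n) ℝ :=
  fun i j => iteratedFDeriv ℝ 2 u x ![EuclideanSpace.single i 1, EuclideanSpace.single j 1]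

/-- `F` is uniformly elliptic with ellipticity constants `0 < lb ≤ ub`:
`lb‖P‖ ≤ F(A+P) − F(A) ≤ ub‖P‖` for all symmetric `A` and positive semidefinite `P`. -/
def UniformlyElliptic {n : ℕ} (F : Matrix (Fin n) (Fin n) ℝ → ℝ) (lb ub : ℝ) : Prop :=
  ∀ (A P : Matrix (Fin n) (Fin n) ℝ), A.IsSymm → P.PosSemidef →
    lb * opNorm P ≤ F (A + P) - F A ∧ F (A + P) - F A ≤ ub * opNorm P

/-- `u` is a viscosity supersolution of `F(D²u) ≤ 0` in `U`: every C² test function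
touching `u` from below at a point of `U` satisfies `F(D²ψ(x₀)) ≤ 0`. -/
def ViscSupersol {n : ℕ} (F : Matrix (Fin n) (Fin n) ℝ → ℝ) (U : Set (Euc n))
    (u : Euc n → ℝ) : Prop :=
  ∀ x₀ ∈ U, ∀ ψ : Euc n → ℝ, ContDiff ℝ 2 ψ → ψ x₀ = u x₀ →
    (∀ᶠ x in nhds x₀, ψ x ≤ u x) → F (hess2 ψ x₀) ≤ 0

/-- `u` is a viscosity subsolution of `F(D²u) ≥ 0` in `U`: every C² test function
touching `u` from above at a point of `U` satisfies `F(D²ψ(x₀)) ≥ 0`. -/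
def ViscSubsol {n : ℕ} (F : Matrix (Fin n) (Fin n) ℝ → ℝ) (U : Set (Euc n))
    (u : Euc n → ℝ) : Prop :=
  ∀ x₀ ∈ U, ∀ ψ : Euc n → ℝ, ContDiff ℝ 2 ψ → ψ x₀ = u x₀ →
    (∀ᶠ x in nhds x₀, u x ≤ ψ x) → 0 ≤ F (hess2 ψ x₀)

/-- `u` solves the fully nonlinear obstacle problem in `Ω` with obstacle `φ`:
`u ∈ C(Ω)`, `u ≥ φ` in `Ω`, `u` is a viscosity supersolution of `F(D²u) ≤ 0` in `Ω`
and a viscosity solution of `F(D²u) = 0` in the non-contact set `{u > φ}`. -/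
def SolvesObstacle {n : ℕ} (F : Matrix (Fin n) (Fin n) ℝ → ℝ) (Ω : Set (Euc n))
    (u φ : Euc n → ℝ) : Prop :=
  ContinuousOn u Ω ∧ (∀ x ∈ Ω, φ x ≤ u x) ∧ ViscSupersol F Ω u ∧
  ViscSupersol F {x ∈ Ω | φ x < u x} u ∧ ViscSubsol F {x ∈ Ω | φ x < u x} u

/-- A modulus: `ω : [0,∞) → [0,∞)` nondecreasing with `ω(0) = 0`. -/
def IsModulus (ω : ℝ → ℝ) : Prop :=
  ω 0 = 0 ∧ MonotoneOn ω (Ici 0) ∧ ∀ r, 0 ≤ r → 0 ≤ ω r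

/-- `φ` is semiconvex on `Ω` with modulus of semiconvexity `ω`: at every `x₀ ∈ Ω` there is
a slope `p` with `φ(x) ≥ φ(x₀) + ⟨p, x − x₀⟩ − ω(|x − x₀|)` on `Ω`. -/
def SemiconvexWithModulus {n : ℕ} (Ω : Set (Euc n)) (φ : Euc n → ℝ) (ω : ℝ → ℝ) : Prop :=
  ∀ x₀ ∈ Ω, ∃ p : Euc n, ∀ x ∈ Ω, φ x₀ + ⟪p, x - x₀⟫ - ω ‖x - x₀‖ ≤ φ x

/-- `p` is the slope of a linear part of `φ` at `x₀` (for modulus `ω`). -/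
def IsLinearPartSlope {n : ℕ} (Ω : Set (Euc n)) (φ : Euc n → ℝ) (ω : ℝ → ℝ)
    (x₀ : Euc n) (p : Euc n) : Prop :=
  ∀ x ∈ Ω, φ x₀ + ⟪p, x - x₀⟫ - ω ‖x - x₀‖ ≤ φ x

/-- `g` is semiconcave with modulus `ω` on `s`. -/
def SemiconcaveWithModulus {n : ℕ} (s : Set (Euc n)) (g : Euc n → ℝ) (ω : ℝ → ℝ) : Prop :=
  ∀ x h : Euc n, x ∈ s → x + h ∈ s → x - h ∈ s →
    g (x + h) + g (x - h) - 2 * g x ≤ ω ‖h‖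

/-- Componentwise order `x ≤ y` on ℝⁿ (`y − x` in the positive cone). -/
def coneLE {n : ℕ} (x y : Euc n) : Prop := ∀ i, x i ≤ y i

/-- The intervention operator `Mu(x) = φ(x) + inf{ u(y) : y ∈ D, y ≥ x }`. -/
def Mop {n : ℕ} (D : Set (Euc n)) (φ u : Euc n → ℝ) (x : Euc n) : ℝ :=
  φ x + sInf (u '' {y ∈ D | coneLE x y})

/-- A bounded domain with `C^{2,α}` boundary, via a global `C^{2,α}` defining function. -/
def IsC2AlphaDomain {n : ℕ} (Ω : Set (Euc n)) (α : ℝ) : Prop :=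
  ∃ ρ : Euc n → ℝ, ContDiff ℝ 2 ρ ∧ Ω = {x | ρ x < 0} ∧
    (∀ x ∈ frontier Ω, fderiv ℝ ρ x ≠ 0) ∧
    ∃ C : ℝ, 0 ≤ C ∧ ∀ x y : Euc n,
      ‖iteratedFDeriv ℝ 2 ρ x - iteratedFDeriv ℝ 2 ρ y‖ ≤ C * ‖x - y‖ ^ α

/-- `u` is a continuous viscosity solution of the fully nonlinear stochastic impulse
control problem on `Ω` with obstacle `Mu` built from `φ`: `u ∈ C(Ω̄)`, `u ≤ Mu` in `Ω`,
`u` is a viscosity subsolution of `F(D²u) ≥ 0` in `Ω`, a viscosity solution of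
`F(D²u) = 0` in `{u < Mu}`, `u = 0` on `∂Ω` and `u ≤ 0` on `Ω̄`. -/
def SolvesImpulse {n : ℕ} (F : Matrix (Fin n) (Fin n) ℝ → ℝ) (Ω : Set (Euc n))
    (u φ : Euc n → ℝ) : Prop :=
  ContinuousOn u (closure Ω) ∧
  (∀ x ∈ Ω, u x ≤ Mop (closure Ω) φ u x) ∧
  ViscSubsol F Ω u ∧
  ViscSubsol F {x ∈ Ω | u x < Mop (closure Ω) φ u x} u ∧
  ViscSupersol F {x ∈ Ω | u x < Mop (closure Ω) φ u x} u ∧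
  (∀ x ∈ frontier Ω, u x = 0) ∧ (∀ x ∈ closure Ω, u x ≤ 0)
theorem mul_norm_sq_le_opNorm_vecMulVec {n : ℕ} (z : Euc n) {c : ℝ} (hc : 0 ≤ c) :
    c * ‖z‖ ^ 2 ≤ opNorm (c • Matrix.vecMulVec z.ofLp z.ofLp) := by
  rcases eq_or_ne z 0 with rfl | hz
  · simp [opNorm]
  have hz' : 0 < ‖z‖ := norm_pos_iff.mpr hz
  have key : Matrix.toEuclideanCLM (𝕜 := ℝ) (c • Matrix.vecMulVec z.ofLp z.ofLp) z
      = (c * ‖z‖ ^ 2) • z := by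
    ext i
    have h : z.ofLp ⬝ᵥ z.ofLp = ‖z‖ ^ 2 := by
      rw [EuclideanSpace.real_norm_sq_eq, dotProduct]
      exact Finset.sum_congr rfl fun j _ => (sq _).symm
    simp [Matrix.ofLp_toEuclideanCLM, Matrix.vecMulVec_mulVec, h]
    ring
  have h := (Matrix.toEuclideanCLM (𝕜 := ℝ) (c • Matrix.vecMulVec z.ofLp z.ofLp)).le_opNorm z
  rw [key, norm_smul, Real.norm_of_nonneg (by positivity)] at h
  exact le_of_mul_le_mul_right h hz'

theorem opNorm_smul_one_le {n : ℕ} {s : ℝ} (hs : 0 ≤ s) :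
    opNorm (s • (1 : Matrix (Fin n) (Fin n) ℝ)) ≤ s := by
  rw [opNorm, map_smul, map_one, norm_smul, Real.norm_of_nonneg hs]
  exact mul_le_of_le_one_right hs ContinuousLinearMap.norm_id_le

/-- A uniformly elliptic operator is positive on `c z zᵀ - s I` once `ub s < lb c |z|²`. -/
theorem UniformlyElliptic.pos_of_lt {n : ℕ} {F : Matrix (Fin n) (Fin n) ℝ → ℝ} {lb ub : ℝ}
    (hF : UniformlyElliptic F lb ub) (hF0 : F 0 = 0) (hlb : 0 < lb) (hub : 0 ≤ ub)
    {c s : ℝ} (hc : 0 ≤ c) (hs : 0 ≤ s) (z : Euc n) (h : ub * s < lb * (c * ‖z‖ ^ 2)) :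
    0 < F (-(s • (1 : Matrix (Fin n) (Fin n) ℝ)) + c • Matrix.vecMulVec z.ofLp z.ofLp) := by
  have hA : (-(s • (1 : Matrix (Fin n) (Fin n) ℝ))).IsSymm := by
    simp [Matrix.IsSymm]
  have hP : (c • Matrix.vecMulVec z.ofLp z.ofLp).PosSemidef := by
    have := Matrix.posSemidef_vecMulVec_self_star z.ofLp
    rw [star_trivial] at this
    exact this.smul hc
  have hQ : (s • (1 : Matrix (Fin n) (Fin n) ℝ)).PosSemidef := Matrix.PosSemidef.one.smul hs
  have h₁ := (hF _ _ hA hP).1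
  have h₂ := (hF _ _ hA hQ).2
  rw [neg_add_cancel, hF0] at h₂
  have h₃ := mul_le_mul_of_nonneg_left (opNorm_smul_one_le (n := n) hs) hub
  have h₄ := mul_le_mul_of_nonneg_left (mul_norm_sq_le_opNorm_vecMulVec z hc) hlb.le
  linarith

/-- A Gaussian bump plus an affine function. -/
def gaussianBarrier {n : ℕ} (T a d : ℝ) (y p : Euc n) (x : Euc n) : ℝ :=
  T * Real.exp (-a * ‖x - y‖ ^ 2) + ⟪p, x⟫ + d

theorem contDiff_gaussianBarrier {n : ℕ} (T a d : ℝ) (y p : Euc n) :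
    ContDiff ℝ 2 (gaussianBarrier T a d y p) := by
  unfold gaussianBarrier
  have h : ContDiff ℝ 2 fun x : Euc n => ‖x - y‖ ^ 2 :=
    (contDiff_id.sub contDiff_const).norm_sq ℝ
  exact ((contDiff_const.mul (Real.contDiff_exp.comp (contDiff_const.mul h))).add
    (contDiff_const.inner ℝ contDiff_id)).add contDiff_const

theorem hasFDerivAt_exp_neg_mul_norm_sub_sq {n : ℕ} (a : ℝ) (y x : Euc n) :
    HasFDerivAt (fun x : Euc n => Real.exp (-a * ‖x - y‖ ^ 2))
      ((-(2 * a) * Real.exp (-a * ‖x - y‖ ^ 2)) • innerSL ℝ (x - y)) x := by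
  have h := ((((hasFDerivAt_id x).sub_const y).norm_sq).const_mul (-a)).exp
  refine h.congr_fderiv ?_
  ext v
  simp
  ring

theorem fderiv_gaussianBarrier {n : ℕ} (T a d : ℝ) (y p : Euc n) :
    fderiv ℝ (gaussianBarrier T a d y p) = fun x =>
      (-(2 * a * T) * Real.exp (-a * ‖x - y‖ ^ 2)) • innerSL ℝ (x - y) + innerSL ℝ p := by
  funext x
  have h := (((hasFDerivAt_exp_neg_mul_norm_sub_sq a y x).const_mul T).add
    (innerSL ℝ p).hasFDerivAt).add_const d
  refine (HasFDerivAt.fderiv (f := gaussianBarrier T a d y p) h).trans ?_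
  rw [smul_smul]
  congr 2
  ring

theorem hess2_gaussianBarrier {n : ℕ} (T a d : ℝ) (y p x : Euc n) :
    hess2 (gaussianBarrier T a d y p) x =
      -((2 * a * T * Real.exp (-a * ‖x - y‖ ^ 2)) • (1 : Matrix (Fin n) (Fin n) ℝ)) +
        (4 * a ^ 2 * T * Real.exp (-a * ‖x - y‖ ^ 2)) •
          Matrix.vecMulVec (x - y).ofLp (x - y).ofLp := by
  have h₁ : HasFDerivAt (fun x : Euc n => innerSL ℝ (x - y)) (innerSL ℝ) x :=
    (innerSL ℝ).hasFDerivAt.comp x ((hasFDerivAt_id x).sub_const y)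
  have h_single (i j : Fin n) : innerSL ℝ (EuclideanSpace.single i (1 : ℝ) : Euc n)
      (EuclideanSpace.single j 1) = (1 : Matrix (Fin n) (Fin n) ℝ) i j := by
    simp [Matrix.one_apply, EuclideanSpace.inner_single_right, eq_comm]
  have h₂ := ((((hasFDerivAt_exp_neg_mul_norm_sub_sq a y x).const_mul (-(2 * a * T))).smul
    h₁).add_const (innerSL ℝ p)).fderiv
  ext i j
  rw [hess2, iteratedFDeriv_two_apply, fderiv_gaussianBarrier]
  simp only [Matrix.cons_val_zero, Matrix.cons_val_one]
  refine (DFunLike.congr_fun (DFunLike.congr_fun h₂ (EuclideanSpace.single i 1))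
    (EuclideanSpace.single j 1)).trans ?_
  simp [Matrix.vecMulVec_apply, EuclideanSpace.inner_single_right]
  erw [h_single]
  ring

/-- A nonnegative supersolution (after subtracting an affine function) that is at least `T` on
the ball of radius `ρ / 2` lies above an explicit barrier on the ball of radius `2ρ`. -/
theorem barrier_le_of_viscSupersol {n : ℕ} {F : Matrix (Fin n) (Fin n) ℝ → ℝ} {lb ub : ℝ}
    (hlb : 0 < lb) (hle : lb ≤ ub) (hF : UniformlyElliptic F lb ub) (hF0 : F 0 = 0)
    {Ω : Set (Euc n)} {u : Euc n → ℝ} (hu : ContinuousOn u Ω) (hsup : ViscSupersol F Ω u)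
    {y p : Euc n} {ρ T b : ℝ} (hρ : 0 < ρ) (hT : 0 < T)
    (hΩ : closedBall y (2 * ρ) ⊆ Ω)
    (hnonneg : ∀ x ∈ closedBall y (2 * ρ), ⟪p, x⟫ + b ≤ u x)
    (hinner : ∀ x ∈ closedBall y (ρ / 2), T + (⟪p, x⟫ + b) ≤ u x)
    {x : Euc n} (hx : x ∈ closedBall y (2 * ρ)) :
    T * (Real.exp (-(4 * ub / lb / ρ ^ 2) * ‖x - y‖ ^ 2) - Real.exp (-(4 * (4 * ub / lb))))
      + (⟪p, x⟫ + b) ≤ u x := by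
  have hub : 0 < ub := hlb.trans_le hle
  set a : ℝ := 4 * ub / lb / ρ ^ 2 with ha
  have ha0 : 0 < a := by positivity
  set k : ℝ := Real.exp (-(4 * (4 * ub / lb))) with hk
  set g : Euc n → ℝ := fun x => gaussianBarrier T a (b - T * k) y p x with hg
  have hgx : ∀ x, g x = T * (Real.exp (-a * ‖x - y‖ ^ 2) - k) + (⟪p, x⟫ + b) := fun x => by
    simp only [hg, gaussianBarrier]; ring
  have hcont : ContinuousOn (fun x => u x - g x) (closedBall y (2 * ρ)) :=
    (hu.mono hΩ).sub (contDiff_gaussianBarrier T a _ y p).continuous.continuousOn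
  obtain ⟨z, hz, hmin⟩ := (isCompact_closedBall y (2 * ρ)).exists_isMinOn ⟨x, hx⟩ hcont
  rw [← hgx]
  by_contra! hlt
  have hneg : u z < g z := by
    have : u z - g z ≤ u x - g x := hmin hx
    linarith
  have hz2 : ‖z - y‖ < 2 * ρ := by
    by_contra! h
    have hexp : Real.exp (-a * ‖z - y‖ ^ 2) ≤ k := by
      apply Real.exp_le_exp.mpr
      have h₁ : (2 * ρ) ^ 2 ≤ ‖z - y‖ ^ 2 := by gcongr
      have h₂ := mul_le_mul_of_nonneg_left h₁ ha0.le
      have h₃ : a * (2 * ρ) ^ 2 = 4 * (4 * ub / lb) := by rw [ha]; field_simp; ring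
      linarith
    have := mul_nonpos_of_nonneg_of_nonpos hT.le (sub_nonpos.mpr hexp)
    have := hnonneg z hz
    have := hgx z
    linarith
  have hz1 : ρ / 2 < ‖z - y‖ := by
    by_contra! h
    have hexp : Real.exp (-a * ‖z - y‖ ^ 2) - k ≤ 1 := by
      have h₁ : Real.exp (-a * ‖z - y‖ ^ 2) ≤ 1 := Real.exp_le_one_iff.mpr (by
        have := mul_nonneg ha0.le (sq_nonneg ‖z - y‖); linarith)
      have := Real.exp_pos (-(4 * (4 * ub / lb)))
      linarith
    have := mul_le_mul_of_nonneg_left hexp hT.le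
    have := hinner z (mem_closedBall_iff_norm.mpr h)
    have := hgx z
    linarith
  have htest := hsup z (hΩ hz) (gaussianBarrier T a (b - T * k + (u z - g z)) y p)
    (contDiff_gaussianBarrier _ _ _ _ _) (by simp only [hg, gaussianBarrier]; ring) (by
      filter_upwards [isOpen_ball.mem_nhds (mem_ball_iff_norm.mpr hz2)] with v hv
      have h : u z - g z ≤ u v - g v := hmin (ball_subset_closedBall hv)
      have : gaussianBarrier T a (b - T * k + (u z - g z)) y p v = g v + (u z - g z) := by
        simp only [hg, gaussianBarrier]; ring
      linarith)
  rw [hess2_gaussianBarrier] at htest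
  refine absurd htest (not_le.mpr (hF.pos_of_lt hF0 hlb hub.le (by positivity) (by positivity) _ ?_))
  set E := Real.exp (-a * ‖z - y‖ ^ 2)
  have hE : 0 < E := Real.exp_pos _
  have h₁ : (ρ / 2) ^ 2 < ‖z - y‖ ^ 2 := by gcongr
  have h₂ : lb * a * (ρ / 2) ^ 2 = ub := by rw [ha]; field_simp; ring
  have h₃ : ub < 2 * (lb * a * ‖z - y‖ ^ 2) := by
    have := mul_lt_mul_of_pos_left h₁ (mul_pos hlb ha0)
    linarith
  have h₄ := mul_lt_mul_of_pos_right h₃ (show 0 < 2 * a * T * E by positivity)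
  linarith

/-- The obstacle has modulus of continuity `ω` up to first order on the
contact set, with a constant depending only on `n`, `λ`, `Λ`. -/
theorem obstacle_modulus_on_contact_set
    (n : ℕ) (lb ub : ℝ) (hlb : 0 < lb) (hle : lb ≤ ub) :
    ∃ C > 0, ∀ (F : Matrix (Fin n) (Fin n) ℝ → ℝ) (Ω : Set (Euc n))
      (u φ : Euc n → ℝ) (ω : ℝ → ℝ) (x₀ x₁ p : Euc n),
      UniformlyElliptic F lb ub → F 0 = 0 → IsOpen Ω →
      SolvesObstacle F Ω u φ →
      IsModulus ω →
      SemiconvexWithModulus Ω φ ω →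
      x₀ ∈ Ω → u x₀ = φ x₀ →
      x₁ ∈ Ω → u x₁ = φ x₁ →
      ball x₀ (4 * ‖x₁ - x₀‖) ⊆ Ω →
      IsLinearPartSlope Ω φ ω x₀ p →
      |φ x₁ - φ x₀ - ⟪p, x₁ - x₀⟫| ≤ C * ω (4 * ‖x₁ - x₀‖) := by
  have hub : 0 < ub := hlb.trans_le hle
  set α : ℝ := 4 * ub / lb with hα
  have hα0 : 0 < α := by positivity
  set c : ℝ := Real.exp (-(9 / 4 * α)) - Real.exp (-(4 * α)) with hc
  have hc0 : 0 < c := sub_pos.mpr (Real.exp_lt_exp.mpr (by linarith))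
  have hc1 : c ≤ 1 := by
    have h₁ : Real.exp (-(9 / 4 * α)) ≤ 1 := Real.exp_le_one_iff.mpr (by linarith)
    have h₂ := Real.exp_pos (-(4 * α))
    linarith
  refine ⟨c⁻¹, inv_pos.mpr hc0, ?_⟩
  intro F Ω u φ ω x₀ x₁ p hF hF0 _ hu hω hsemi hx₀ hux₀ hx₁ hux₁ hball hp
  obtain ⟨hucont, huge, hsup, -, -⟩ := hu
  obtain ⟨hω0, hωmono, hωnonneg⟩ := hω
  rcases eq_or_ne x₁ x₀ with rfl | hne
  · simp [hω0]
  set ρ := ‖x₁ - x₀‖ with hρdef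
  have hρ : 0 < ρ := norm_pos_iff.mpr (sub_ne_zero.mpr hne)
  have hW : 0 ≤ ω (4 * ρ) := hωnonneg _ (by positivity)
  have hωle : ∀ r, 0 ≤ r → r ≤ 4 * ρ → ω r ≤ ω (4 * ρ) := fun r h₀ h₁ =>
    hωmono h₀ (show (0 : ℝ) ≤ 4 * ρ by positivity) h₁
  have hWc : ω (4 * ρ) ≤ c⁻¹ * ω (4 * ρ) :=
    le_mul_of_one_le_left hW ((one_le_inv₀ hc0).mpr hc1)
  set T := φ x₁ - φ x₀ - ⟪p, x₁ - x₀⟫ with hT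
  have hlow : -ω (4 * ρ) ≤ T := by
    have h₁ := hp x₁ hx₁
    have h₂ := hωle ρ hρ.le (by linarith)
    linarith
  refine abs_le.mpr ⟨by linarith, ?_⟩
  rcases le_or_gt T 0 with hT0 | hT0
  · linarith
  obtain ⟨q, hq⟩ := hsemi x₁ hx₁
  obtain ⟨e, he, hinc⟩ : ∃ e : Euc n, ‖e‖ = 1 ∧ ⟪q - p, e⟫ = ‖q - p‖ := by
    rcases eq_or_ne (q - p) 0 with h | h
    · refine ⟨ρ⁻¹ • (x₁ - x₀), ?_, by simp [h]⟩
      rw [norm_smul, Real.norm_of_nonneg (by positivity), ← hρdef, inv_mul_cancel₀ hρ.ne']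
    · have h' : ‖q - p‖ ≠ 0 := norm_ne_zero_iff.mpr h
      refine ⟨‖q - p‖⁻¹ • (q - p), ?_, ?_⟩
      · rw [norm_smul, norm_inv, norm_norm, inv_mul_cancel₀ h']
      · rw [inner_smul_right, real_inner_self_eq_norm_sq]
        field_simp
  set y := x₁ + (ρ / 2) • e with hy
  have hyx₁ : ‖y - x₁‖ = ρ / 2 := by
    rw [hy, add_sub_cancel_left, norm_smul, he, Real.norm_of_nonneg (by positivity), mul_one]
  have hyx₀ : ‖y - x₀‖ ≤ 3 / 2 * ρ := by
    have := norm_sub_le_norm_sub_add_norm_sub y x₁ x₀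
    linarith
  have hfar : ∀ x ∈ closedBall y (2 * ρ), ‖x - x₀‖ < 4 * ρ := fun x hx => by
    have h₁ := norm_sub_le_norm_sub_add_norm_sub x y x₀
    have h₂ := mem_closedBall_iff_norm.mp hx
    linarith
  have hsub : closedBall y (2 * ρ) ⊆ Ω := fun x hx =>
    hball (mem_ball_iff_norm.mpr (hfar x hx))
  have key := barrier_le_of_viscSupersol (p := p) (b := φ x₀ - ⟪p, x₀⟫ - ω (4 * ρ))
    hlb hle hF hF0 hucont hsup hρ hT0 hsub
    (fun x hx => by
      have h₁ := hp x (hsub hx)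
      have h₂ := hωle _ (norm_nonneg _) (hfar x hx).le
      have h₃ := huge x (hsub hx)
      rw [inner_sub_right] at h₁
      linarith)
    (fun x hx => by
      have hxy := mem_closedBall_iff_norm.mp hx
      have hxΩ : x ∈ Ω := hsub (closedBall_subset_closedBall (by linarith) hx)
      have h₁ := hq x hxΩ
      have h₂ : ‖x - x₁‖ ≤ 4 * ρ := by
        have := norm_sub_le_norm_sub_add_norm_sub x y x₁
        linarith
      have h₃ := hωle _ (norm_nonneg _) h₂
      have h₄ := huge x hxΩ
      have h₅ : 0 ≤ ⟪q - p, x - x₁⟫ := by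
        have h₆ : x - x₁ = (x - y) + (ρ / 2) • e := by rw [hy]; abel
        have h₇ := (abs_le.mp (abs_real_inner_le_norm (q - p) (x - y))).1
        have h₈ := mul_le_mul_of_nonneg_left hxy (norm_nonneg (q - p))
        rw [h₆, inner_add_right, inner_smul_right, hinc]
        linarith
      rw [inner_sub_left, inner_sub_right p] at h₅
      rw [inner_sub_right] at hT
      linarith)
    (x := x₀) (mem_closedBall_iff_norm.mpr (by rw [norm_sub_rev]; linarith))
  have hbar : c ≤ Real.exp (-(4 * ub / lb / ρ ^ 2) * ‖x₀ - y‖ ^ 2)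
      - Real.exp (-(4 * (4 * ub / lb))) := by
    refine sub_le_sub_right (Real.exp_le_exp.mpr ?_) _
    rw [norm_sub_rev, ← hα]
    have h₁ : ‖y - x₀‖ ^ 2 ≤ (3 / 2 * ρ) ^ 2 := by gcongr
    have h₂ := mul_le_mul_of_nonneg_left h₁ (show 0 ≤ α / ρ ^ 2 by positivity)
    have h₃ : α / ρ ^ 2 * (3 / 2 * ρ) ^ 2 = 9 / 4 * α := by field_simp; ring
    linarith
  have h := mul_le_mul_of_nonneg_left hbar hT0.le
  rw [le_inv_mul_iff₀ hc0]
  linarith
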